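/- Let d ≥ 1, m ≥ 1, let x₁, …, x_m ∈ ℝ^d, and fix y ∈ ℝ^d. Suppose there is an index k with ‖y − x_k‖ < ‖y − x_j‖ for all j ≠ k. Then the rescaled gradient-field norm converges to the distance to the point set: σ² · ‖∇log A_σ(y)‖ → ‖y − x_k‖ = minᵢ ‖y − xᵢ‖ as σ → 0⁺. -/

import Mathlib

open MeasureTheory Real Filter Topology
open scoped InnerProductSpace ENNReal BigOperators

/-- The Gaussian kernel `q_σ(y, x) = (2πσ²)^{-d/2} exp(−‖y − x‖²/(2σ²))` on `ℝ^d`. -/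
noncomputable def gaussKernel (d : ℕ) (σ : ℝ) (y x : EuclideanSpace ℝ (Fin d)) : ℝ :=
  (2 * π * σ ^ 2) ^ (-(d : ℝ) / 2) * Real.exp (-‖y - x‖ ^ 2 / (2 * σ ^ 2))

/-- The smoothed density `Q_σ(y) = ∫ q_σ(y, x) dP(x)`. -/
noncomputable def smoothedDensity (d : ℕ) (σ : ℝ)
    (P : Measure (EuclideanSpace ℝ (Fin d))) (y : EuclideanSpace ℝ (Fin d)) : ℝ :=
  ∫ x, gaussKernel d σ y x ∂P

/-- The score `∇ log Q_σ` of the smoothed density. -/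
noncomputable def score (d : ℕ) (σ : ℝ) (P : Measure (EuclideanSpace ℝ (Fin d)))
    (y : EuclideanSpace ℝ (Fin d)) : EuclideanSpace ℝ (Fin d) :=
  gradient (fun z => Real.log (smoothedDensity d σ P z)) y

/-- The Gaussian-mixture density `A_σ(y) = (1/m) Σᵢ q_σ(y, xᵢ)`. -/
noncomputable def mixDensity (d m : ℕ) (σ : ℝ) (x : Fin m → EuclideanSpace ℝ (Fin d))
    (y : EuclideanSpace ℝ (Fin d)) : ℝ :=
  (1 / (m : ℝ)) * ∑ i, gaussKernel d σ y (x i)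

/-- The softmax weights `wᵢ(y, σ) = exp(−‖y − xᵢ‖²/(2σ²)) / Σⱼ exp(−‖y − xⱼ‖²/(2σ²))`. -/
noncomputable def softmaxW {d m : ℕ} (x : Fin m → EuclideanSpace ℝ (Fin d))
    (y : EuclideanSpace ℝ (Fin d)) (σ : ℝ) (i : Fin m) : ℝ :=
  Real.exp (-‖y - x i‖ ^ 2 / (2 * σ ^ 2)) / ∑ j, Real.exp (-‖y - x j‖ ^ 2 / (2 * σ ^ 2))

theorem gaussKernel_pos {d : ℕ} {σ : ℝ} (hσ : 0 < σ) (y x : EuclideanSpace ℝ (Fin d)) :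
    0 < gaussKernel d σ y x := by
  unfold gaussKernel
  positivity

theorem hasGradientAt_gaussKernel {d : ℕ} {σ : ℝ} (hσ : σ ≠ 0)
    (y x : EuclideanSpace ℝ (Fin d)) :
    HasGradientAt (fun z => gaussKernel d σ z x)
      ((σ ^ 2)⁻¹ • gaussKernel d σ y x • (x - y)) y := by
  rw [hasGradientAt_iff_hasFDerivAt]
  have h := (((((hasFDerivAt_id y).sub_const x).norm_sq.neg).mul_const
    (2 * σ ^ 2)⁻¹).exp).const_mul ((2 * π * σ ^ 2) ^ (-(d : ℝ) / 2))
  simp only [id, ← div_eq_mul_inv] at h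
  refine h.congr_fderiv ?_
  ext v
  simp [gaussKernel]
  field_simp
  ring

theorem sum_gaussKernel_pos {d m : ℕ} (hm : 1 ≤ m) {σ : ℝ} (hσ : 0 < σ)
    (x : Fin m → EuclideanSpace ℝ (Fin d)) (y : EuclideanSpace ℝ (Fin d)) :
    0 < ∑ i, gaussKernel d σ y (x i) :=
  Finset.sum_pos (fun i _ => gaussKernel_pos hσ y (x i)) ⟨⟨0, hm⟩, Finset.mem_univ _⟩

theorem softmaxW_eq_gaussKernel_div_sum {d m : ℕ} {σ : ℝ} (hσ : 0 < σ)
    (x : Fin m → EuclideanSpace ℝ (Fin d)) (y : EuclideanSpace ℝ (Fin d)) (i : Fin m) :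
    softmaxW x y σ i = gaussKernel d σ y (x i) / ∑ j, gaussKernel d σ y (x j) := by
  have h : (2 * π * σ ^ 2) ^ (-(d : ℝ) / 2) ≠ 0 := by positivity
  simp only [softmaxW, gaussKernel, ← Finset.mul_sum]
  rw [mul_div_mul_left _ _ h]

theorem gradient_log_mixDensity {d m : ℕ} (hm : 1 ≤ m) {σ : ℝ} (hσ : 0 < σ)
    (x : Fin m → EuclideanSpace ℝ (Fin d)) (y : EuclideanSpace ℝ (Fin d)) :
    gradient (fun z => Real.log (mixDensity d m σ x z)) y =
      (σ ^ 2)⁻¹ • ∑ i, softmaxW x y σ i • (x i - y) := by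
  have hm' : (0 : ℝ) < m := by exact_mod_cast hm
  have hS := sum_gaussKernel_pos hm hσ x y
  apply HasGradientAt.gradient
  rw [hasGradientAt_iff_hasFDerivAt]
  have h := ((HasFDerivAt.fun_sum (u := Finset.univ) fun i _ =>
    (hasGradientAt_gaussKernel hσ.ne' y (x i)).hasFDerivAt).const_mul (1 / (m : ℝ))).log
    (by positivity)
  refine h.congr_fderiv ?_
  ext v
  simp only [map_smul, map_sum, softmaxW_eq_gaussKernel_div_sum hσ, one_div, smul_eq_mul,
    Finset.smul_sum, smul_apply, sum_apply]
  refine Finset.sum_congr rfl fun i _ => ?_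
  field_simp

theorem tendsto_exp_neg_div_sq_zero {c : ℝ} (hc : 0 < c) :
    Tendsto (fun σ : ℝ => Real.exp (-c / (2 * σ ^ 2))) (𝓝[>] 0) (𝓝 0) := by
  have h : Tendsto (fun σ : ℝ => c / 2 * (σ⁻¹) ^ 2) (𝓝[>] 0) atTop :=
    ((tendsto_pow_atTop two_ne_zero).comp tendsto_inv_nhdsGT_zero).const_mul_atTop (half_pos hc)
  refine (Real.tendsto_exp_neg_atTop_nhds_zero.comp h).congr fun σ => ?_
  simp only [Function.comp_apply]
  congr 1
  rw [inv_pow, ← div_eq_mul_inv, div_div, neg_div]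

/-- As `σ → 0⁺` the softmax weights concentrate on the unique nearest point. -/
theorem tendsto_softmaxW {d m : ℕ} (x : Fin m → EuclideanSpace ℝ (Fin d))
    (y : EuclideanSpace ℝ (Fin d)) (k : Fin m)
    (hk : ∀ j, j ≠ k → ‖y - x k‖ < ‖y - x j‖) (i : Fin m) :
    Tendsto (fun σ => softmaxW x y σ i) (𝓝[>] 0) (𝓝 (if i = k then 1 else 0)) := by
  have key (j : Fin m) : Tendsto
      (fun σ : ℝ => Real.exp (-(‖y - x j‖ ^ 2 - ‖y - x k‖ ^ 2) / (2 * σ ^ 2)))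
      (𝓝[>] 0) (𝓝 (if j = k then 1 else 0)) := by
    split_ifs with h
    · simp [h]
    · exact tendsto_exp_neg_div_sq_zero
        (sub_pos.2 (pow_lt_pow_left₀ (hk j h) (norm_nonneg _) two_ne_zero))
  have hsum := tendsto_finsetSum Finset.univ fun j _ => key j
  rw [Finset.sum_ite_eq' Finset.univ k, if_pos (Finset.mem_univ k)] at hsum
  have hdiv := (key i).div hsum one_ne_zero
  rw [div_one] at hdiv
  refine hdiv.congr fun σ => ?_
  have he (j : Fin m) : Real.exp (-(‖y - x j‖ ^ 2 - ‖y - x k‖ ^ 2) / (2 * σ ^ 2)) =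
      Real.exp (-‖y - x j‖ ^ 2 / (2 * σ ^ 2)) / Real.exp (-‖y - x k‖ ^ 2 / (2 * σ ^ 2)) := by
    rw [← Real.exp_sub]
    ring_nf
  simp only [Pi.div_apply, he, ← Finset.sum_div, softmaxW]
  exact div_div_div_cancel_right₀ (Real.exp_ne_zero _) _ _

/-- In the low-noise limit the rescaled gradient-field norm converges to the distance to the
point set: `σ² ‖∇log A_σ(y)‖ → ‖y − x_k‖ = minᵢ ‖y − xᵢ‖` as `σ → 0⁺`. -/
theorem rescaled_gradient_norm_tendsto_distance
    (d : ℕ) (hd : 1 ≤ d) (m : ℕ) (hm : 1 ≤ m)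
    (x : Fin m → EuclideanSpace ℝ (Fin d)) (y : EuclideanSpace ℝ (Fin d))
    (k : Fin m) (hk : ∀ j, j ≠ k → ‖y - x k‖ < ‖y - x j‖) :
    Tendsto (fun σ => σ ^ 2 * ‖gradient (fun z => Real.log (mixDensity d m σ x z)) y‖)
      (𝓝[>] (0 : ℝ)) (𝓝 ‖y - x k‖) ∧
    ‖y - x k‖ = ⨅ i, ‖y - x i‖ := by
  refine ⟨?_, ?_⟩
  · have h := (tendsto_finsetSum Finset.univ fun i _ =>
      (tendsto_softmaxW x y k hk i).smul_const (x i - y)).norm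
    simp only [ite_smul, one_smul, zero_smul, Finset.sum_ite_eq', Finset.mem_univ, if_true] at h
    rw [norm_sub_rev]
    refine h.congr' ?_
    filter_upwards [self_mem_nhdsWithin] with σ hσ
    have hσ' : (0 : ℝ) < σ := hσ
    rw [gradient_log_mixDensity hm hσ', norm_smul, Real.norm_of_nonneg (by positivity),
      mul_inv_cancel_left₀ (by positivity)]
  · have : Nonempty (Fin m) := ⟨k⟩
    refine le_antisymm (le_ciInf fun i => ?_) (ciInf_le (Set.finite_range _).bddBelow k)
    rcases eq_or_ne i k with rfl | h
    · exact le_rfl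
    · exact (hk i h).le
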